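/- (Kenyon–Peres theorem, reproved.) Let Λ_Φ be a Sierpiński sponge in any dimension d ≥ 1. Then HD(Λ_Φ) = sup_{p∈P} HD(ν_p), the supremum of the Hausdorff dimensions of its Bernoulli measures. -/

import Mathlib

open MeasureTheory Filter Set Metric
open scoped Classical Topology ENNReal NNReal

namespace SelfAffineSponge

/-- A diagonal IFS on `[0,1]^d`: for each coordinate `i ∈ D = Fin d` a finite alphabet
`A i` indexing affine maps `x ↦ slope i a * x + off i a` of `[0,1]`, together with a
set `E ⊆ ∏ i, A i` of allowed tuples of symbols. -/
structure DiagIFS (d : ℕ) (A : Fin d → Type) [∀ i, Fintype (A i)] where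
  slope : ∀ i : Fin d, A i → ℝ
  off : ∀ i : Fin d, A i → ℝ
  E : Finset (∀ i, A i)

variable {d : ℕ} {A : Fin d → Type} [∀ i, Fintype (A i)]

namespace DiagIFS

/-- the base similarity `φ_{i,a}` in coordinate `i` -/
def base (Φ : DiagIFS d A) (i : Fin d) (a : A i) (x : ℝ) : ℝ :=
  Φ.slope i a * x + Φ.off i a

/-- the data defines an honest diagonal IFS: `E` is nonempty and each base map is a
contracting similarity of `[0,1]` -/
def Valid (Φ : DiagIFS d A) : Prop :=
  Φ.E.Nonempty ∧ (∀ i a, Φ.slope i a ≠ 0) ∧ (∀ i a, |Φ.slope i a| < 1) ∧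
    ∀ i a, ∀ x ∈ Set.Icc (0:ℝ) 1, Φ.base i a x ∈ Set.Icc (0:ℝ) 1

/-- the alphabet `E` of the IFS, as a type -/
abbrev Symb (Φ : DiagIFS d A) : Type _ := {a : ∀ i, A i // a ∈ Φ.E}

instance (Φ : DiagIFS d A) : MeasurableSpace Φ.Symb := ⊤
instance (Φ : DiagIFS d A) : TopologicalSpace Φ.Symb := ⊥

/-- the affine contraction `φ_a` of `[0,1]^d` associated to a tuple of symbols -/
def affMap (Φ : DiagIFS d A) (a : ∀ i, A i) (x : Fin d → ℝ) : Fin d → ℝ :=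
  fun i => Φ.base i (a i) (x i)

/-- the coding map `π(ω) = lim_n φ_{ω_0}∘⋯∘φ_{ω_{n-1}}(0)`, written in closed form -/
noncomputable def coding (Φ : DiagIFS d A) (ω : ℕ → Φ.Symb) : Fin d → ℝ :=
  fun i => ∑' n : ℕ, (∏ k ∈ Finset.range n, Φ.slope i ((ω k).1 i)) * Φ.off i ((ω n).1 i)

/-- the limit set `Λ_Φ = π(E^ℕ)` (the self-affine sponge) -/
def limitSet (Φ : DiagIFS d A) : Set (Fin d → ℝ) :=
  Set.range Φ.coding

theorem coding_mem (Φ : DiagIFS d A) (ω : ℕ → Φ.Symb) : Φ.coding ω ∈ Φ.limitSet :=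
  ⟨ω, rfl⟩

/-- the `i`-th Lyapunov exponent `χ_i(p) = -∫ log|φ'_{a,i}| dp(a)` of a finite measure
`p` on `E` (given by its density) -/
noncomputable def chi (Φ : DiagIFS d A) (i : Fin d) (p : Φ.Symb → ℝ) : ℝ :=
  -∑ a : Φ.Symb, p a * Real.log |Φ.slope i (a.1 i)|

/-- the mass `p([a]_I)` of the cylinder `[a]_I = {b ∈ E : b_i = a_i ∀ i ∈ I}` -/
noncomputable def cylMass (Φ : DiagIFS d A) (I : Finset (Fin d)) (p : Φ.Symb → ℝ)
    (a : Φ.Symb) : ℝ :=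
  ∑ b : Φ.Symb, if ∀ i ∈ I, b.1 i = a.1 i then p b else 0

/-- the entropy `h(I; p) = -∫ log p([a]_I) dp(a)` -/
noncomputable def entropy (Φ : DiagIFS d A) (I : Finset (Fin d)) (p : Φ.Symb → ℝ) : ℝ :=
  -∑ a : Φ.Symb, p a * Real.log (Φ.cylMass I p a)

/-- the conditional entropy `h(I' | I; p) = h(I';p) - h(I;p)` -/
noncomputable def condEntropy (Φ : DiagIFS d A) (I I' : Finset (Fin d))
    (p : Φ.Symb → ℝ) : ℝ :=
  Φ.entropy I' p - Φ.entropy I p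

/-- a coordinate set `I ⊆ D` is good if the projected IFS `Φ_I` satisfies the open set
condition: the boxes `φ_{I,a}((0,1)^I)`, indexed by distinct projections of elements of
`E`, are pairwise disjoint (equivalently, some coordinate has disjoint intervals). -/
def GoodIdx (Φ : DiagIFS d A) (I : Finset (Fin d)) : Prop :=
  ∀ a ∈ Φ.E, ∀ b ∈ Φ.E, (∃ i ∈ I, a i ≠ b i) →
    ∃ i ∈ I, Disjoint (Φ.base i (a i) '' Set.Ioo (0:ℝ) 1)
      (Φ.base i (b i) '' Set.Ioo (0:ℝ) 1)

/-- Barański condition: each base IFS satisfies the open set condition w.r.t. `(0,1)` -/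
def Baranski (Φ : DiagIFS d A) : Prop :=
  ∀ i : Fin d, ∀ a b : A i, a ≠ b →
    Disjoint (Φ.base i a '' Set.Ioo (0:ℝ) 1) (Φ.base i b '' Set.Ioo (0:ℝ) 1)

/-- strong Barański condition: each base IFS satisfies the strong separation condition
w.r.t. `[0,1]` -/
def StronglyBaranski (Φ : DiagIFS d A) : Prop :=
  ∀ i : Fin d, ∀ a b : A i, a ≠ b →
    Disjoint (Φ.base i a '' Set.Icc (0:ℝ) 1) (Φ.base i b '' Set.Icc (0:ℝ) 1)

/-- coordinate ordering condition: some permutation `σ` of the coordinates has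
`|φ'_{a,σ(1)}| > ⋯ > |φ'_{a,σ(d)}|` for all `a ∈ E` -/
def CoordOrdering (Φ : DiagIFS d A) : Prop :=
  ∃ σ : Equiv.Perm (Fin d), ∀ a ∈ Φ.E, ∀ i j : Fin d, i < j →
    |Φ.slope (σ j) (a (σ j))| < |Φ.slope (σ i) (a (σ i))|

end DiagIFS

/-- a probability vector (probability measure on a finite set, via its density) -/
def IsProbVec {α : Type*} [Fintype α] (p : α → ℝ) : Prop :=
  (∀ a, 0 ≤ p a) ∧ ∑ a, p a = 1

/-- a measure `p` on `E` is good if `I(p,x) = {i : χ_i(p) ≤ x}` is good for all `x > 0` -/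
def DiagIFS.GoodVec (Φ : DiagIFS d A) (p : Φ.Symb → ℝ) : Prop :=
  ∀ x > 0, Φ.GoodIdx (Finset.univ.filter fun i => Φ.chi i p ≤ x)

/-- a cycle on `E`: a continuous exponentially `λ`-periodic map `(0,∞) → P`,
where `λ = 1` means constant -/
structure Cycle (Φ : DiagIFS d A) where
  lam : ℝ
  one_le_lam : 1 ≤ lam
  r : ℝ → Φ.Symb → ℝ
  prob : ∀ b > 0, IsProbVec (r b)
  cont : ContinuousOn r (Set.Ioi 0)
  periodic : ∀ b > 0, r (lam * b) = r b
  const_of_lam_eq_one : lam = 1 → ∀ b > 0, ∀ b' > 0, r b = r b'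

/-- the number `B_i`, determined by `B = ∫_0^{B_i} χ_i(r_b) db` (written via `sInf`;
for a cycle the function `x ↦ ∫_0^x χ_i(r_b) db` is continuous and strictly
increasing, so the infimum is the unique solution) -/
noncomputable def Bcoord (Φ : DiagIFS d A) (r : ℝ → Φ.Symb → ℝ) (B : ℝ) (i : Fin d) : ℝ :=
  sInf {x : ℝ | 0 ≤ x ∧ B ≤ ∫ b in Set.Ioc (0:ℝ) x, Φ.chi i (r b)}

/-- `δ(r, B) = B⁻¹ ∫_0^∞ h({i : b ≤ B_i}; r_b) db` -/
noncomputable def deltaRB (Φ : DiagIFS d A) (r : ℝ → Φ.Symb → ℝ) (B : ℝ) : ℝ :=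
  B⁻¹ * ∫ b in Set.Ioi (0:ℝ),
    Φ.entropy (Finset.univ.filter fun i => b ≤ Bcoord Φ r B i) (r b)

/-- `δ(r) = inf_{B ∈ [1,λ]} δ(r,B)` -/
noncomputable def Cycle.delta {Φ : DiagIFS d A} (c : Cycle Φ) : ℝ :=
  sInf (deltaRB Φ c.r '' Set.Icc 1 c.lam)

/-- `δ(p) = ∫_0^∞ h({i : b ≤ 1/χ_i(p)}; p) db` -/
noncomputable def deltaP (Φ : DiagIFS d A) (p : Φ.Symb → ℝ) : ℝ :=
  ∫ b in Set.Ioi (0:ℝ),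
    Φ.entropy (Finset.univ.filter fun i => b ≤ (Φ.chi i p)⁻¹) p

/-- the normalized average `R̂_B = B⁻¹ ∫_0^B r_b db` of a cycle -/
noncomputable def cycleAvg {Φ : DiagIFS d A} (c : Cycle Φ) (B : ℝ) : Φ.Symb → ℝ :=
  fun a => B⁻¹ * ∫ b in Set.Ioc (0:ℝ) B, c.r b a

/-- a cycle is good if all its normalized averages `R̂_B` are good -/
def Cycle.Good {Φ : DiagIFS d A} (c : Cycle Φ) : Prop :=
  ∀ B > 0, Φ.GoodVec (cycleAvg c B)

/-- a cycle is nondegenerate if `{b > 0 : r_b(a) > 0 ∀ a ∈ E_r}` is dense in `(0,∞)` -/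
def Cycle.Nondeg {Φ : DiagIFS d A} (c : Cycle Φ) : Prop :=
  Set.Ioi (0:ℝ) ⊆
    closure {b : ℝ | 0 < b ∧ ∀ a : Φ.Symb, (∃ b' > 0, 0 < c.r b' a) → 0 < c.r b a}

/-- the lower pointwise dimension `d̲(x,μ) = liminf_{ρ→0} log μ(B(x,ρ))/log ρ` -/
noncomputable def lowerPtDim {X : Type*} [PseudoMetricSpace X] [MeasurableSpace X]
    (μ : Measure X) (x : X) : ℝ≥0∞ :=
  Filter.liminf
    (fun ρ : ℝ => ENNReal.ofReal (Real.log (μ (Metric.ball x ρ)).toReal / Real.log ρ))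
    (𝓝[>] (0:ℝ))

/-- the Hausdorff dimension of a measure: the essential supremum of its lower
pointwise dimension -/
noncomputable def measDim {X : Type*} [PseudoMetricSpace X] [MeasurableSpace X]
    (μ : Measure X) : ℝ≥0∞ :=
  essSup (lowerPtDim μ) μ

/-- the shift map on `E^ℕ` -/
def shift {α : Type*} (ω : ℕ → α) : ℕ → α := fun n => ω (n + 1)

/-- the dynamical dimension: the supremum of `HD(π_*μ)` over shift-invariant
probability measures `μ` on `E^ℕ` -/
noncomputable def DiagIFS.dynDim (Φ : DiagIFS d A) : ℝ≥0∞ :=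
  sSup {x : ℝ≥0∞ | ∃ μ : Measure (ℕ → Φ.Symb), IsProbabilityMeasure μ ∧
    Measure.map shift μ = μ ∧ x = measDim (Measure.map Φ.coding μ)}

/-- `μ` is the product measure on `E^ℕ` whose `k`-th factor has density `p k`
(this property characterizes `μ` uniquely) -/
def IsProductMeasure (Φ : DiagIFS d A) (p : ℕ → Φ.Symb → ℝ)
    (μ : Measure (ℕ → Φ.Symb)) : Prop :=
  IsProbabilityMeasure μ ∧
    ∀ (n : ℕ) (w : ℕ → Φ.Symb),
      (μ {ω | ∀ k < n, ω k = w k}).toReal = ∏ k ∈ Finset.range n, p k (w k)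

/-- the set of Hausdorff dimensions of Bernoulli measures `ν_p = π_*[p^ℕ]` -/
noncomputable def bernoulliDims (Φ : DiagIFS d A) : Set ℝ≥0∞ :=
  {x | ∃ p : Φ.Symb → ℝ, IsProbVec p ∧ ∃ μ : Measure (ℕ → Φ.Symb),
    IsProductMeasure Φ (fun _ => p) μ ∧ x = measDim (Measure.map Φ.coding μ)}

/-- the set of Hausdorff dimensions of pseudo-Bernoulli measures
`ν_r = π_*[∏_n r_n]` -/
noncomputable def pseudoBernoulliDims (Φ : DiagIFS d A) : Set ℝ≥0∞ :=
  {x | ∃ c : Cycle Φ, ∃ μ : Measure (ℕ → Φ.Symb),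
    IsProductMeasure Φ (fun n => c.r ((n : ℝ) + 1)) μ ∧
      x = measDim (Measure.map Φ.coding μ)}

/-- **Mass distribution principle.** If a finite measure charges `A` and the mass of small balls
centred in `A` is at most `C * ρ ^ t`, then `dimH A ≥ t`. -/
theorem le_dimH_of_measure_closedBall_le {X : Type*} [MetricSpace X] [MeasurableSpace X]
    [BorelSpace X] {ν : Measure X} {A : Set X} (hA : ν A ≠ 0) {t : ℝ≥0} (ht : 0 < t)
    {C : ℝ} (hC : 0 < C) {ρ₀ : ℝ} (hρ₀ : 0 < ρ₀)
    (h : ∀ x ∈ A, ∀ ρ : ℝ, 0 < ρ → ρ < ρ₀ → ν (closedBall x ρ) ≤ ENNReal.ofReal (C * ρ ^ (t : ℝ))) :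
    (t : ℝ≥0∞) ≤ dimH A := by
  have hC' : ENNReal.ofReal C ≠ 0 := by simpa using hC
  have hCt : ENNReal.ofReal C ≠ ∞ := ENNReal.ofReal_ne_top
  have key : ∀ s : Set X, ediam s ≤ ENNReal.ofReal (ρ₀ / 2) →
      ((ENNReal.ofReal C)⁻¹ • ν.restrict A) s ≤ ediam s ^ (t : ℝ) := by
    intro s hs
    have hfin : ediam s ≠ ∞ := ne_top_of_le_ne_top ENNReal.ofReal_ne_top hs
    have hdiam : diam s < ρ₀ := by
      have : diam s ≤ ρ₀ / 2 := ENNReal.toReal_le_of_le_ofReal (by positivity) hs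
      linarith
    rw [Measure.smul_apply, smul_eq_mul, ENNReal.inv_mul_le_iff hC' hCt]
    refine (measure_mono subset_closure).trans ?_
    rw [Measure.restrict_apply isClosed_closure.measurableSet]
    rcases (closure s ∩ A).eq_empty_or_nonempty with he | ⟨x, hxs, hxA⟩
    · simp [he]
    have hfin' : Bornology.IsBounded (closure s) :=
      (isBounded_iff_ediam_ne_top.2 hfin).closure
    have hev : ∀ᶠ ρ in 𝓝[>] (diam s), ν (closure s ∩ A) ≤ ENNReal.ofReal (C * ρ ^ (t : ℝ)) := by
      filter_upwards [Ioo_mem_nhdsGT hdiam] with ρ hρ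
      refine (measure_mono ?_).trans (h x hxA ρ (diam_nonneg.trans_lt hρ.1) hρ.2)
      intro y hy
      rw [mem_closedBall]
      refine (dist_le_diam_of_mem hfin' hy.1 hxs).trans ?_
      rw [diam_closure]
      exact hρ.1.le
    have hlim : Tendsto (fun ρ : ℝ => ENNReal.ofReal (C * ρ ^ (t : ℝ))) (𝓝[>] (diam s))
        (𝓝 (ENNReal.ofReal (C * (diam s) ^ (t : ℝ)))) := by
      refine ENNReal.tendsto_ofReal (Tendsto.const_mul _ ?_)
      exact ((Real.continuousAt_rpow_const _ _ (Or.inr (by positivity))).tendsto).mono_left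
        nhdsWithin_le_nhds
    refine (ge_of_tendsto hlim hev).trans ?_
    rw [ENNReal.ofReal_mul hC.le, ← ENNReal.ofReal_rpow_of_nonneg diam_nonneg t.coe_nonneg,
      diam, ENNReal.ofReal_toReal hfin]
  have hle := Measure.le_hausdorffMeasure (t : ℝ) _ _ (by simpa using hρ₀) key
  refine le_dimH_of_hausdorffMeasure_ne_zero (d := t) ?_
  intro h0
  have := hle A
  rw [h0, Measure.smul_apply, Measure.restrict_apply_self] at this
  simp [hA, hCt] at this

/-- If every point of `A` is the centre of arbitrarily small balls of mass at least `ρ ^ t`,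
then `dimH A ≤ t`. -/
theorem dimH_le_of_frequently_le_measure_closedBall {X : Type*} [MetricSpace X]
    [SecondCountableTopology X] [MeasurableSpace X] [BorelSpace X] {ν : Measure X}
    [IsFiniteMeasure ν] {A : Set X} {t : ℝ≥0}
    (h : ∀ x ∈ A, ∃ᶠ ρ : ℝ in 𝓝[>] 0, ENNReal.ofReal (ρ ^ (t : ℝ)) ≤ ν (closedBall x ρ)) :
    dimH A ≤ t := by
  have hchoose : ∀ n : ℕ, ∀ x : A, ∃ ρ : ℝ, 0 < ρ ∧ ρ < 1 / ((n : ℝ) + 1) ∧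
      ENNReal.ofReal (ρ ^ (t : ℝ)) ≤ ν (closedBall (x : X) ρ) := by
    intro n x
    obtain ⟨ρ, h1, h2⟩ := ((h x x.2).and_eventually
      (Ioo_mem_nhdsGT (show (0 : ℝ) < 1 / ((n : ℝ) + 1) by positivity))).exists
    exact ⟨ρ, h2.1, h2.2, h1⟩
  choose ρ hρ0 hρ1 hρ2 using hchoose
  have hvit := fun n : ℕ => Vitali.exists_disjoint_subfamily_covering_enlargement_closedBall
    (univ : Set A) (fun x => (x : X)) (ρ n) (1 / ((n : ℝ) + 1)) (fun a _ => (hρ1 n a).le) 5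
    (by norm_num)
  choose u _ hdisj hcov using hvit
  have hcount : ∀ n, (u n).Countable := by
    intro n
    refine (hdisj n).countable_of_nonempty_interior ?_
    intro x _
    exact ⟨x, ball_subset_interior_closedBall (mem_ball_self (hρ0 n x))⟩
  have : ∀ n, Countable (u n) := fun n => (hcount n).to_subtype
  have hsub : ∀ n, A ⊆ ⋃ i : u n, closedBall ((i : A) : X) (5 * ρ n i) := by
    intro n x hx
    obtain ⟨b, hb, hxb⟩ := hcov n ⟨x, hx⟩ (mem_univ _)
    exact mem_iUnion.2 ⟨⟨b, hb⟩, hxb (mem_closedBall_self (hρ0 n _).le)⟩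
  have hdiam : ∀ n, ∀ i : u n, ediam (closedBall ((i : A) : X) (5 * ρ n i)) ≤
      ENNReal.ofReal (10 * ρ n i) := by
    intro n i
    refine (ediam_le_of_forall_dist_le (C := 10 * ρ n i) ?_)
    intro x hx y hy
    have := dist_triangle_right x y ((i : A) : X)
    rw [mem_closedBall] at hx hy
    linarith
  have hH := Measure.hausdorffMeasure_le_liminf_tsum (t : ℝ) A (l := atTop)
    (fun n : ℕ => ENNReal.ofReal (10 * (1 / ((n : ℝ) + 1))))
    (by
      rw [show (0 : ℝ≥0∞) = ENNReal.ofReal (10 * 0) by simp]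
      exact ENNReal.tendsto_ofReal (tendsto_one_div_add_atTop_nhds_zero_nat.const_mul _))
    (fun n (i : u n) => closedBall ((i : A) : X) (5 * ρ n i))
    (Eventually.of_forall fun n i => (hdiam n i).trans
      (ENNReal.ofReal_le_ofReal (by linarith [hρ1 n i])))
    (Eventually.of_forall hsub)
  have hbound : ∀ n, ∑' i : u n, ediam (closedBall ((i : A) : X) (5 * ρ n i)) ^ (t : ℝ) ≤
      ENNReal.ofReal (10 ^ (t : ℝ)) * ν univ := by
    intro n
    calc ∑' i : u n, ediam (closedBall ((i : A) : X) (5 * ρ n i)) ^ (t : ℝ)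
        ≤ ∑' i : u n, ENNReal.ofReal (10 ^ (t : ℝ)) * ν (closedBall ((i : A) : X) (ρ n i)) := by
          refine ENNReal.tsum_le_tsum fun i => ?_
          refine (ENNReal.rpow_le_rpow (hdiam n i) t.coe_nonneg).trans ?_
          rw [ENNReal.ofReal_rpow_of_nonneg (by linarith [hρ0 n i]) t.coe_nonneg,
            Real.mul_rpow (by norm_num) (hρ0 n i).le, ENNReal.ofReal_mul (by positivity)]
          gcongr
          exact hρ2 n i
      _ = ENNReal.ofReal (10 ^ (t : ℝ)) *
            ν (⋃ i ∈ u n, closedBall (i : X) (ρ n i)) := by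
          rw [ENNReal.tsum_mul_left, measure_biUnion (hcount n) (hdisj n)
            (fun i _ => isClosed_closedBall.measurableSet)]
      _ ≤ _ := by gcongr; exact subset_univ _
  refine dimH_le_of_hausdorffMeasure_ne_top (d := t) (ne_top_of_le_ne_top ?_ (hH.trans
    (liminf_le_of_frequently_le' (Frequently.of_forall hbound))))
  exact ENNReal.mul_ne_top ENNReal.ofReal_ne_top (measure_ne_top _ _)

/-- A finite measure concentrated on `Λ` has dimension at most `dimH Λ`. -/
theorem measDim_le_dimH {X : Type*} [MetricSpace X] [MeasurableSpace X] [BorelSpace X]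
    {ν : Measure X} [IsFiniteMeasure ν] {Λ : Set X} (hΛ : ν Λᶜ = 0) : measDim ν ≤ dimH Λ := by
  by_contra! hlt
  obtain ⟨s, hs1, hs2⟩ := ENNReal.lt_iff_exists_nnreal_btwn.1 hlt
  have hs0 : 0 < s := by exact_mod_cast (zero_le.trans_lt hs1)
  set B : Set X := {x | (s : ℝ≥0∞) < lowerPtDim ν x} with hB
  have hνB : ν B ≠ 0 := by
    intro h0
    refine absurd hs2 (not_lt.2 (essSup_le_of_ae_le _ ?_))
    rw [EventuallyLE, ae_iff]
    convert h0 using 2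
    ext x
    simp [hB]
  set A : ℕ → Set X := fun n => {x | ∀ ρ : ℝ, 0 < ρ → ρ < 1 / ((n : ℝ) + 1) →
    ν (closedBall x ρ) ≤ ENNReal.ofReal (2 ^ (s : ℝ) * ρ ^ (s : ℝ))} with hAdef
  have hBA : B ⊆ ⋃ n, A n := by
    intro x hx
    have hev := eventually_lt_of_lt_liminf (show (s : ℝ≥0∞) < lowerPtDim ν x from hx)
    obtain ⟨ε, hε, hεs⟩ := mem_nhdsGT_iff_exists_Ioo_subset.1 hev
    rw [mem_Ioi] at hε
    obtain ⟨n, hn⟩ := exists_nat_one_div_lt (show (0 : ℝ) < min ε 1 / 2 by positivity)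
    refine mem_iUnion.2 ⟨n, fun ρ hρ0 hρ => ?_⟩
    have hlt : 2 * ρ < min ε 1 := by linarith
    have hmem : 2 * ρ ∈ Ioo 0 ε := ⟨by linarith, hlt.trans_le (min_le_left _ _)⟩
    have h1 := hεs hmem
    simp only [mem_ofPred_eq] at h1
    have hlog : Real.log (2 * ρ) < 0 :=
      Real.log_neg (by linarith) (hlt.trans_le (min_le_right _ _))
    refine (measure_mono (closedBall_subset_ball (show ρ < 2 * ρ by linarith))).trans ?_
    rw [← Real.mul_rpow (by norm_num) hρ0.le]
    refine ENNReal.le_ofReal_iff_toReal_le (measure_ne_top _ _) (by positivity) |>.2 ?_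
    rcases (ENNReal.toReal_nonneg (a := ν (ball x (2 * ρ)))).eq_or_lt with h0 | hpos
    · rw [← h0]; positivity
    · rw [ENNReal.lt_ofReal_iff_toReal_lt ENNReal.coe_ne_top, ENNReal.coe_toReal,
        lt_div_iff_of_neg hlog] at h1
      rw [← Real.log_le_log_iff hpos (by positivity), Real.log_rpow (by positivity)]
      exact h1.le
  have hνBΛ : ν (B ∩ Λ) ≠ 0 := by
    rwa [measure_inter_conull hΛ]
  obtain ⟨n, hn⟩ : ∃ n, ν (A n ∩ Λ) ≠ 0 := by
    by_contra! h0
    refine hνBΛ (measure_mono_null ?_ (measure_iUnion_null h0))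
    rw [← iUnion_inter]
    gcongr
  have := le_dimH_of_measure_closedBall_le hn hs0 (C := 2 ^ (s : ℝ)) (by positivity)
    (show (0 : ℝ) < 1 / ((n : ℝ) + 1) by positivity) (fun x hx ρ h0 h1 => hx.1 ρ h0 h1)
  exact absurd (this.trans (dimH_mono inter_subset_right)) (not_le.2 hs1)

/-- Points of positive local mass where the lower pointwise dimension is less than `s` form a set
of Hausdorff dimension at most `s`. -/
theorem dimH_lowerPtDim_lt_le {X : Type*} [MetricSpace X] [SecondCountableTopology X]
    [MeasurableSpace X] [BorelSpace X] {ν : Measure X} [IsFiniteMeasure ν] {Λ : Set X}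
    (hpos : ∀ x ∈ Λ, ∀ ρ : ℝ, 0 < ρ → ν (ball x ρ) ≠ 0) (s : ℝ≥0) :
    dimH {x ∈ Λ | lowerPtDim ν x < s} ≤ s := by
  refine dimH_le_of_frequently_le_measure_closedBall (ν := ν) fun x hx => ?_
  have hf := frequently_lt_of_liminf_lt (f := 𝓝[>] (0 : ℝ)) (h := hx.2)
  refine (hf.and_eventually (Ioo_mem_nhdsGT one_pos)).mono ?_
  rintro ρ ⟨h1, h0, hρ1⟩
  have hm : 0 < (ν (ball x ρ)).toReal :=
    ENNReal.toReal_pos (hpos x hx.1 ρ h0) (measure_ne_top _ _)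
  have hlog := Real.log_neg h0 hρ1
  refine le_trans ?_ (measure_mono ball_subset_closedBall)
  refine ENNReal.ofReal_le_iff_le_toReal (measure_ne_top _ _) |>.2 ?_
  rw [← Real.log_le_log_iff (by positivity) hm, Real.log_rpow h0]
  have h2 : Real.log (ν (ball x ρ)).toReal / Real.log ρ < s := by
    by_contra! hc
    refine absurd h1 (not_lt.2 ?_)
    rw [← ENNReal.ofReal_coe_nnreal]
    exact ENNReal.ofReal_le_ofReal hc
  exact ((div_lt_iff_of_neg hlog).1 h2).le

/-- A lower bound on `measDim ν` from a nonzero measure absolutely continuous with respect to `ν`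
whose balls of radius `ρ` have mass at most `C * ρ ^ s`. -/
theorem le_measDim_of_absolutelyContinuous {X : Type*} [MetricSpace X] [SecondCountableTopology X]
    [MeasurableSpace X] [BorelSpace X] {ν ν' : Measure X} [IsFiniteMeasure ν]
    {Λ : Set X} (hΛ : ν Λᶜ = 0) (hpos : ∀ x ∈ Λ, ∀ ρ : ℝ, 0 < ρ → ν (ball x ρ) ≠ 0)
    (hac : ν' ≪ ν) (hν' : ν' ≠ 0) {s : ℝ≥0} {C : ℝ} (hC : 0 < C) {ρ₀ : ℝ} (hρ₀ : 0 < ρ₀)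
    (h : ∀ x, ∀ ρ : ℝ, 0 < ρ → ρ < ρ₀ → ν' (closedBall x ρ) ≤ ENNReal.ofReal (C * ρ ^ (s : ℝ))) :
    (s : ℝ≥0∞) ≤ measDim ν := by
  by_contra! hlt
  obtain ⟨t, ht1, ht2⟩ := ENNReal.lt_iff_exists_nnreal_btwn.1 hlt
  have hs0 : 0 < s := by exact_mod_cast (zero_le.trans_lt ht2)
  have hae : ∀ᵐ x ∂ν', x ∈ {x ∈ Λ | lowerPtDim ν x < t} := by
    refine hac.ae_le ?_
    filter_upwards [ae_lt_of_essSup_lt ht1, compl_mem_ae_iff.2 hΛ] with x h1 h2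
    exact ⟨by simpa using h2, h1⟩
  have hne : ν' {x ∈ Λ | lowerPtDim ν x < t} ≠ 0 := by
    intro h0
    have := (measure_eq_zero_iff_ae_notMem.1 h0).and hae
    simp only [not_and_self_iff, eventually_false_iff_eq_bot, ae_eq_bot] at this
    exact hν' this
  have h1 := le_dimH_of_measure_closedBall_le hne hs0 hC hρ₀ (fun x _ => h x)
  exact absurd (h1.trans (dimH_lowerPtDim_lt_le hpos t)) (not_le.2 ht2)

section Weights

variable {S : Type*} [Fintype S]

/-- the symbols whose first `j` digits agree with those of `a` -/
noncomputable def cyl (f : ℕ → S → ℕ) (j : ℕ) (a : S) : Finset S :=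
  Finset.univ.filter fun b => ∀ i < j, f i b = f i a

theorem mem_cyl {f : ℕ → S → ℕ} {j : ℕ} {a b : S} : b ∈ cyl f j a ↔ ∀ i < j, f i b = f i a := by
  simp [cyl]

theorem mem_cyl_self (f : ℕ → S → ℕ) (j : ℕ) (a : S) : a ∈ cyl f j a := by simp [mem_cyl]

theorem cyl_card_pos (f : ℕ → S → ℕ) (j : ℕ) (a : S) : (0 : ℝ) < (cyl f j a).card := by
  exact_mod_cast Finset.card_pos.2 ⟨a, mem_cyl_self f j a⟩

theorem cyl_eq_of_mem {f : ℕ → S → ℕ} {j : ℕ} {a b : S} (h : b ∈ cyl f j a) :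
    cyl f j b = cyl f j a := by
  ext c
  rw [mem_cyl] at h
  simp only [mem_cyl]
  exact forall₂_congr fun i hi => by rw [h i hi]

theorem cyl_antitone (f : ℕ → S → ℕ) {j k : ℕ} (h : j ≤ k) (a : S) : cyl f k a ⊆ cyl f j a := by
  intro b hb
  rw [mem_cyl] at hb ⊢
  exact fun i hi => hb i (hi.trans_le h)

theorem sum_cyl_eq_sum_average (f : ℕ → S → ℕ) (j : ℕ) (a : S) (F : S → ℝ) :
    ∑ b ∈ cyl f j a, F b =
      ∑ b ∈ cyl f j a, (∑ c ∈ cyl f (j + 1) b, F c) / (cyl f (j + 1) b).card := by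
  have h1 : ∑ b ∈ cyl f j a, (∑ c ∈ cyl f (j + 1) b, F c) / (cyl f (j + 1) b).card =
      ∑ b ∈ cyl f j a, ∑ c ∈ cyl f (j + 1) b, F c / (cyl f (j + 1) c).card := by
    refine Finset.sum_congr rfl fun b _ => ?_
    rw [Finset.sum_div]
    exact Finset.sum_congr rfl fun c hc => by rw [cyl_eq_of_mem hc]
  rw [h1, Finset.sum_comm' (t' := cyl f j a) (s' := fun c => cyl f (j + 1) c)]
  · refine Finset.sum_congr rfl fun c _ => ?_
    rw [Finset.sum_const, nsmul_eq_mul, mul_div_cancel₀ _ (cyl_card_pos f _ _).ne']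
  · intro b c
    simp only [mem_cyl]
    constructor
    · rintro ⟨h, h'⟩
      exact ⟨fun i hi => (h' i hi).symm, fun i hi => (h' i (by omega)).trans (h i hi)⟩
    · rintro ⟨h, h'⟩
      exact ⟨fun i hi => (h i (by omega)).trans (h' i hi), fun i hi => (h i hi).symm⟩

/-- The Kenyon–Peres weights: logarithms `z j` of the iterated partition functions, which only
depend on the first `j` digits, whose associated probability vector has explicit marginals. -/
theorem exists_weights [Nonempty S] (f : ℕ → S → ℕ) (d : ℕ)
    (hf : ∀ a b, (∀ i < d, f i a = f i b) → a = b) (β : ℕ → ℝ) :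
    ∃ z : ℕ → S → ℝ, (∀ a, z d a = 0) ∧ (∃ z₀, ∀ a, z 0 a = z₀) ∧
      ∀ j ≤ d, ∀ a, ∑ b ∈ cyl f j a,
        Real.exp (∑ i ∈ Finset.range d, (β i * z (i + 1) b - z i b)) =
          Real.exp (∑ i ∈ Finset.range j, (β i * z (i + 1) a - z i a)) := by
  obtain ⟨z, hzd, hz⟩ : ∃ z : ℕ → S → ℝ, (∀ a, z d a = 0) ∧ ∀ j < d, ∀ a,
      z j a = Real.log (∑ b ∈ cyl f j a,
        Real.exp (β j * z (j + 1) b) / (cyl f (j + 1) b).card) := by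
    let W : ℕ → S → ℝ := fun n => Nat.rec (fun _ => 0) (fun n w a =>
      Real.log (∑ b ∈ cyl f (d - (n + 1)) a,
        Real.exp (β (d - (n + 1)) * w b) / (cyl f (d - (n + 1) + 1) b).card)) n
    refine ⟨fun j => W (d - j), fun a => by simp [W], fun j hj a => ?_⟩
    obtain ⟨n, rfl⟩ : ∃ n, d = j + (n + 1) := ⟨d - j - 1, by omega⟩
    have h1 : j + (n + 1) - j = n + 1 := by omega
    have h2 : j + (n + 1) - (j + 1) = n := by omega
    have h3 : j + (n + 1) - (n + 1) = j := by omega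
    simp only [h1, h2, W, h3]
  have hzcyl : ∀ j ≤ d, ∀ a b, b ∈ cyl f j a → z j b = z j a := by
    intro j hj a b hb
    rcases hj.lt_or_eq with h | rfl
    · rw [hz j h, hz j h, cyl_eq_of_mem hb]
    · rw [hzd, hzd]
  refine ⟨z, hzd, ?_, ?_⟩
  · obtain ⟨a₀⟩ := ‹Nonempty S›
    exact ⟨z 0 a₀, fun a => hzcyl 0 (Nat.zero_le _) a₀ a (by simp [mem_cyl])⟩
  intro j hj
  induction hj using Nat.decreasingInduction with
  | self =>
    intro a
    have : cyl f d a = {a} := by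
      ext b
      rw [mem_cyl, Finset.mem_singleton]
      exact ⟨hf b a, by rintro rfl; simp⟩
    rw [this, Finset.sum_singleton]
  | of_succ j hj ih =>
    intro a
    have hpos : 0 < ∑ b ∈ cyl f j a, Real.exp (β j * z (j + 1) b) / (cyl f (j + 1) b).card :=
      Finset.sum_pos (fun b _ => div_pos (Real.exp_pos _) (cyl_card_pos f _ b))
        ⟨a, mem_cyl_self f j a⟩
    rw [sum_cyl_eq_sum_average]
    calc _ = ∑ b ∈ cyl f j a, (Real.exp (∑ i ∈ Finset.range j, (β i * z (i + 1) a - z i a)) *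
          Real.exp (-z j a)) * (Real.exp (β j * z (j + 1) b) / (cyl f (j + 1) b).card) := by
          refine Finset.sum_congr rfl fun b hb => ?_
          have hcongr : ∑ i ∈ Finset.range j, (β i * z (i + 1) b - z i b) =
              ∑ i ∈ Finset.range j, (β i * z (i + 1) a - z i a) := by
            refine Finset.sum_congr rfl fun i hi => ?_
            rw [Finset.mem_range] at hi
            rw [hzcyl i (by omega) a b (cyl_antitone f hi.le a hb),
              hzcyl (i + 1) (by omega) a b (cyl_antitone f hi a hb)]
          rw [ih b, Finset.sum_range_succ, hzcyl j hj.le a b hb, hcongr, ← mul_div_assoc,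
            ← Real.exp_add, ← Real.exp_add]
          congr 2
          ring
      _ = _ := by
          rw [← Finset.mul_sum, mul_assoc]
          conv_rhs => rw [← mul_one (Real.exp _)]
          congr 1
          rw [hz j hj, Real.exp_neg, Real.exp_log hpos, inv_mul_cancel₀ hpos.ne']

end Weights

/-- A finite sum of differences of translates of bounded functions cannot stay below a negative
constant. -/
theorem frequently_neg_lt_sum_sub_translate (n : ℕ) (F : ℕ → ℝ → ℝ) (hF : ∀ j, Measurable (F j))
    (C : ℕ → ℝ) (hC : ∀ j t, |F j t| ≤ C j) (u v : ℕ → ℝ) {ε : ℝ} (hε : 0 < ε) :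
    ∃ᶠ t in atTop, -ε < ∑ j ∈ Finset.range n, (F j (t + u j) - F j (t + v j)) := by
  by_contra hcon
  rw [not_frequently] at hcon
  obtain ⟨T₀, hT₀⟩ := eventually_atTop.1 hcon
  have hint : ∀ j a b, IntervalIntegrable (F j) volume a b := fun j a b =>
    (intervalIntegrable_const (c := C j)).mono_fun' (hF j).aestronglyMeasurable
      (Eventually.of_forall fun t => by simpa using hC j t)
  have hint' : ∀ j a b w, IntervalIntegrable (fun t => F j (t + w)) volume a b := fun j a b w =>
    (intervalIntegrable_const (c := C j)).mono_fun'
      ((hF j).comp (measurable_id.add_const w)).aestronglyMeasurable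
      (Eventually.of_forall fun t => by simpa using hC j (t + w))
  set K : ℝ := ∑ j ∈ Finset.range n, 2 * (C j * |u j - v j|) with hK
  have hK0 : 0 ≤ K := Finset.sum_nonneg fun j _ => by
    have := (abs_nonneg _).trans (hC j 0)
    positivity
  set T : ℝ := T₀ + (K / ε + 1) with hT
  have hTT : T₀ ≤ T := by
    have : 0 ≤ K / ε := by positivity
    linarith
  have hupper : ∫ t in T₀..T, ∑ j ∈ Finset.range n, (F j (t + u j) - F j (t + v j)) ≤
      -ε * (T - T₀) := by
    refine (intervalIntegral.integral_mono_on (g := fun _ => -ε) hTT ?_ (by simp)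
      fun t ht => not_lt.1 (hT₀ t ht.1)).trans ?_
    · simpa only [Finset.sum_fn] using IntervalIntegrable.sum (Finset.range n)
        fun j _ => (hint' j T₀ T (u j)).sub (hint' j T₀ T (v j))
    · rw [intervalIntegral.integral_const, smul_eq_mul, mul_comm]
  have hlower : -K ≤ ∫ t in T₀..T, ∑ j ∈ Finset.range n, (F j (t + u j) - F j (t + v j)) := by
    rw [intervalIntegral.integral_finsetSum
      fun j _ => (hint' j _ _ _).sub (hint' j _ _ _), hK, ← Finset.sum_neg_distrib]
    refine Finset.sum_le_sum fun j _ => ?_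
    rw [intervalIntegral.integral_sub (hint' j _ _ _) (hint' j _ _ _),
      intervalIntegral.integral_comp_add_right (F j), intervalIntegral.integral_comp_add_right (F j),
      intervalIntegral.integral_interval_sub_interval_comm (hint _ _ _) (hint _ _ _) (hint _ _ _)]
    have hb : ∀ w, |∫ t in (w + u j)..(w + v j), F j t| ≤ C j * |u j - v j| := by
      intro w
      have := intervalIntegral.norm_integral_le_of_norm_le_const (f := F j) (C := C j)
        (a := w + u j) (b := w + v j) (fun t _ => hC j t)
      rwa [add_sub_add_left_eq_sub, abs_sub_comm] at this
    have h1 := abs_le.1 (hb T₀)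
    have h2 := abs_le.1 (hb T)
    linarith [h1.1, h2.2]
  have : ε * (T - T₀) = K + ε := by
    rw [hT]
    field_simp
    ring
  linarith

/-- the cylinder around `ω` fixing, for each `j < d`, the first `N j` entries of the `j`-th
digit sequence -/
def symbCube {S : Type*} (f : ℕ → S → ℕ) (d : ℕ) (N : ℕ → ℕ) (ω : ℕ → S) : Set (ℕ → S) :=
  {τ | ∀ j < d, ∀ k < N j, f j (τ k) = f j (ω k)}

theorem exists_lt_iff_lt_of_antitone {N : ℕ → ℕ} (hN : Antitone N) (d k : ℕ) :
    ∃ c ≤ d, ∀ j < d, (k < N j ↔ j < c) := by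
  induction d with
  | zero => exact ⟨0, le_rfl, by simp⟩
  | succ d ih =>
    obtain ⟨c, hc, h⟩ := ih
    by_cases hk : k < N d
    · refine ⟨d + 1, le_rfl, fun j hj => ?_⟩
      have := hN (Nat.le_of_lt_succ hj)
      exact ⟨fun _ => hj, fun _ => hk.trans_le this⟩
    · refine ⟨c, hc.trans d.le_succ, fun j hj => ?_⟩
      rcases (Nat.le_of_lt_succ hj).lt_or_eq with hj' | rfl
      · exact h j hj'
      · exact ⟨fun h' => absurd h' hk, fun h' => by omega⟩

/-- the average of `z` along the first `⌊x⌋₊` entries of `ω` -/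
noncomputable def birkhoffMean {S : Type*} (z : S → ℝ) (ω : ℕ → S) (x : ℝ) : ℝ :=
  (∑ k ∈ Finset.range ⌊x⌋₊, z (ω k)) / x

theorem measurable_birkhoffMean {S : Type*} (z : S → ℝ) (ω : ℕ → S) :
    Measurable (birkhoffMean z ω) :=
  ((measurable_from_nat (f := fun n => ∑ k ∈ Finset.range n, z (ω k))).comp
    Nat.measurable_floor).div measurable_id

theorem abs_birkhoffMean_le {S : Type*} [Fintype S] (z : S → ℝ) (ω : ℕ → S) {x : ℝ}
    (hx : 0 < x) :
    |birkhoffMean z ω x| ≤ ∑ a, |z a| := by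
  rw [birkhoffMean, abs_div, abs_of_pos hx, div_le_iff₀ hx]
  calc |∑ k ∈ Finset.range ⌊x⌋₊, z (ω k)| ≤ ∑ k ∈ Finset.range ⌊x⌋₊, |z (ω k)| :=
        Finset.abs_sum_le_sum_abs _ _
    _ ≤ ∑ k ∈ Finset.range ⌊x⌋₊, ∑ a, |z a| := Finset.sum_le_sum fun k _ =>
        Finset.single_le_sum (f := fun a => |z a|) (fun a _ => abs_nonneg _) (Finset.mem_univ _)
    _ = ⌊x⌋₊ * ∑ a, |z a| := by simp
    _ ≤ x * ∑ a, |z a| := by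
        gcongr
        exact Nat.floor_le hx.le
    _ = _ := mul_comm _ _

section SymbolicMeasure

variable {S : Type*} [Fintype S] [MeasurableSpace S]

/-- the measure on a finite type with density `p` -/
noncomputable def densityMeasure (p : S → ℝ) : Measure S :=
  ∑ a, ENNReal.ofReal (p a) • Measure.dirac a

theorem densityMeasure_finset [MeasurableSingletonClass S] {p : S → ℝ} (hp : ∀ a, 0 ≤ p a)
    (s : Finset S) : densityMeasure p (s : Set S) = ENNReal.ofReal (∑ a ∈ s, p a) := by
  rw [densityMeasure, Measure.finsetSum_apply, ENNReal.ofReal_sum_of_nonneg fun a _ => hp a]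
  simp only [Measure.smul_apply, smul_eq_mul, Measure.dirac_apply, indicator_apply,
    Finset.mem_coe, Pi.one_apply, mul_ite, mul_one, mul_zero]
  rw [Finset.sum_ite_mem, Finset.univ_inter]

theorem isProbabilityMeasure_densityMeasure [MeasurableSingletonClass S] {p : S → ℝ}
    (hp : IsProbVec p) : IsProbabilityMeasure (densityMeasure p) := by
  refine ⟨?_⟩
  rw [← Finset.coe_univ, densityMeasure_finset hp.1, hp.2, ENNReal.ofReal_one]

/-- Mass of a cylinder for the Bernoulli measure of a probability vector whose marginals on the
first `j` digits are `exp (∑ i < j, y i)`. -/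
theorem infinitePi_symbCube [MeasurableSingletonClass S] (f : ℕ → S → ℕ) {d : ℕ}
    {p : S → ℝ} (hp : IsProbVec p) (y : ℕ → S → ℝ)
    (hy : ∀ j ≤ d, ∀ a, ∑ b ∈ cyl f j a, p b = Real.exp (∑ i ∈ Finset.range j, y i a))
    {N : ℕ → ℕ} (hN : Antitone N) (ω : ℕ → S) :
    (Measure.infinitePi fun _ : ℕ => densityMeasure p).real (symbCube f d N ω) =
      Real.exp (∑ j ∈ Finset.range d, ∑ k ∈ Finset.range (N j), y j (ω k)) := by
  have := isProbabilityMeasure_densityMeasure hp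
  choose c hcd hc using exists_lt_iff_lt_of_antitone hN d
  have hset : symbCube f d N ω =
      Set.pi (Finset.range (N 0) : Set ℕ) fun k => (cyl f (c k) (ω k) : Set S) := by
    ext τ
    simp only [symbCube, Set.mem_pi, Finset.coe_range, mem_Iio, Finset.mem_coe, mem_cyl]
    constructor
    · intro h k _ i hi
      have hid := hi.trans_le (hcd k)
      exact h i hid k ((hc k i hid).2 hi)
    · intro h j hj k hk
      exact h k (hk.trans_le (hN (Nat.zero_le j))) j ((hc k j hj).1 hk)
  rw [hset, measureReal_def, Measure.infinitePi_pi _ fun k _ => (Set.toFinite _).measurableSet]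
  simp only [densityMeasure_finset hp.1]
  rw [ENNReal.toReal_prod]
  calc _ = ∏ k ∈ Finset.range (N 0), Real.exp (∑ i ∈ Finset.range (c k), y i (ω k)) := by
        refine Finset.prod_congr rfl fun k _ => ?_
        rw [hy _ (hcd k), ENNReal.toReal_ofReal (Real.exp_pos _).le]
    _ = _ := by
        rw [← Real.exp_sum, Finset.sum_comm' (t' := Finset.range d)
          (s' := fun j => Finset.range (N j))]
        intro k j
        simp only [Finset.mem_range]
        constructor
        · rintro ⟨_, hj⟩
          have := hj.trans_le (hcd k)
          exact ⟨(hc k j this).2 hj, this⟩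
        · rintro ⟨hk, hj⟩
          exact ⟨hk.trans_le (hN (Nat.zero_le j)), (hc k j hj).1 hk⟩

/-- The strong law of large numbers for the Bernoulli measure of `p`. -/
theorem ae_tendsto_birkhoffMean [MeasurableSingletonClass S] {p : S → ℝ} (hp : IsProbVec p)
    (z : S → ℝ) : ∃ m : ℝ, ∀ᵐ ω ∂(Measure.infinitePi fun _ : ℕ => densityMeasure p),
      Tendsto (birkhoffMean z ω) atTop (𝓝 m) := by
  have := isProbabilityMeasure_densityMeasure hp
  have hz : Measurable z := measurable_of_finite z
  have hX : ∀ i : ℕ, Measurable fun ω : ℕ → S => z (ω i) :=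
    fun i => hz.comp (measurable_pi_apply i)
  refine ⟨∫ ω, z (ω 0) ∂(Measure.infinitePi fun _ : ℕ => densityMeasure p), ?_⟩
  have hslln := ProbabilityTheory.strong_law_ae_real
    (μ := Measure.infinitePi fun _ : ℕ => densityMeasure p) (fun i ω => z (ω i)) ?_ ?_ ?_
  · filter_upwards [hslln] with ω hω
    have h1 := (hω.comp (tendsto_nat_floor_atTop (α := ℝ))).mul
      (tendsto_nat_floor_div_atTop (R := ℝ))
    rw [mul_one] at h1
    refine h1.congr' ?_
    filter_upwards [eventually_ge_atTop (1 : ℝ)] with x hx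
    have hfl : (⌊x⌋₊ : ℝ) ≠ 0 := by
      have := Nat.floor_pos.2 hx
      positivity
    simp only [Function.comp, birkhoffMean]
    field_simp
  · refine Integrable.of_bound (hX 0).aestronglyMeasurable (∑ a, |z a|)
      (Eventually.of_forall fun ω => ?_)
    exact Finset.single_le_sum (f := fun a => |z a|) (fun a _ => abs_nonneg _) (Finset.mem_univ _)
  · intro i j hij
    exact (ProbabilityTheory.iIndepFun_infinitePi (P := fun _ : ℕ => densityMeasure p)
      (X := fun _ => z) (fun _ => hz)).indepFun hij
  · intro i
    refine ⟨(hX i).aemeasurable, (hX 0).aemeasurable, ?_⟩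
    have h1 : ∀ i : ℕ, Measure.map (fun ω : ℕ → S => z (ω i))
        (Measure.infinitePi fun _ : ℕ => densityMeasure p) = (densityMeasure p).map z := by
      intro i
      have := Measure.infinitePi_map_eval (fun _ : ℕ => densityMeasure p) i
      conv_rhs => rw [← this]
      rw [Measure.map_map hz (measurable_pi_apply i)]
      rfl
    rw [h1, h1]

/-- A Bernoulli measure for which all cylinders of approximate side `exp (-L)` have, infinitely
often, mass at least about `exp (-δ L)`, and almost surely mass at most about `exp (-δ L)`. -/
theorem exists_bernoulli_symbCube [Nonempty S] [MeasurableSingletonClass S] (f : ℕ → S → ℕ)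
    {d : ℕ} (hd : 1 ≤ d) (hf : ∀ a b, (∀ i < d, f i a = f i b) → a = b) (l : ℕ → ℝ)
    (hl0 : ∀ j, 0 < l j) (hl : Monotone l) :
    ∃ p : S → ℝ, IsProbVec p ∧ ∃ δ : ℝ,
      (∀ ω, ∀ ε > 0, ∃ᶠ L in atTop, Real.exp (-(δ + ε) * L) ≤
        (Measure.infinitePi fun _ : ℕ => densityMeasure p).real
          (symbCube f d (fun j => ⌊L / l j⌋₊) ω)) ∧
      ∀ᵐ ω ∂(Measure.infinitePi fun _ : ℕ => densityMeasure p), ∀ ε > 0, ∀ᶠ L in atTop,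
        (Measure.infinitePi fun _ : ℕ => densityMeasure p).real
          (symbCube f d (fun j => ⌊L / l j⌋₊) ω) ≤ Real.exp (-(δ - ε) * L) := by
  obtain ⟨e, rfl⟩ : ∃ e, d = e + 1 := ⟨d - 1, by omega⟩
  obtain ⟨z, hzd, ⟨z₀, hz0⟩, hz⟩ := exists_weights f (e + 1) hf fun j => l j / l (j + 1)
  set y : ℕ → S → ℝ := fun i a => l i / l (i + 1) * z (i + 1) a - z i a with hy
  set p : S → ℝ := fun a => Real.exp (∑ i ∈ Finset.range (e + 1), y i a) with hpdef
  have hp : IsProbVec p := by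
    refine ⟨fun a => (Real.exp_pos _).le, ?_⟩
    obtain ⟨a⟩ := ‹Nonempty S›
    have := hz 0 (Nat.zero_le _) a
    simpa [cyl] using this
  have hmass : ∀ L : ℝ, 0 ≤ L → ∀ ω,
      (Measure.infinitePi fun _ : ℕ => densityMeasure p).real
        (symbCube f (e + 1) (fun j => ⌊L / l j⌋₊) ω) = Real.exp (∑ j ∈ Finset.range (e + 1),
          ∑ k ∈ Finset.range ⌊L / l j⌋₊, y j (ω k)) := by
    intro L hL ω
    refine infinitePi_symbCube f hp y hz (fun i j hij => ?_) ω
    exact Nat.floor_mono (div_le_div_of_nonneg_left hL (hl0 i) (hl hij))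
  set H : (ℕ → S) → ℝ → ℝ := fun ω L => ∑ j ∈ Finset.range e,
    ((l (j + 1))⁻¹ * birkhoffMean (z (j + 1)) ω (L / l j) -
      (l (j + 1))⁻¹ * birkhoffMean (z (j + 1)) ω (L / l (j + 1))) with hH
  have hlog : ∀ L : ℝ, 0 < L → ∀ ω, ∑ j ∈ Finset.range (e + 1),
      ∑ k ∈ Finset.range ⌊L / l j⌋₊, y j (ω k) = L * H ω L - ⌊L / l 0⌋₊ * z₀ := by
    intro L hL ω
    simp only [hy, Finset.sum_sub_distrib, ← Finset.mul_sum]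
    rw [Finset.sum_range_succ, Finset.sum_range_succ' (fun j => ∑ k ∈ _, z j (ω k))]
    simp only [hzd, hz0, Finset.sum_const_zero, mul_zero, add_zero, Finset.sum_const,
      Finset.card_range, nsmul_eq_mul]
    rw [← sub_sub, ← Finset.sum_sub_distrib, hH, Finset.mul_sum]
    congr 1
    refine Finset.sum_congr rfl fun j _ => ?_
    have h1 := (hl0 j).ne'
    have h2 := (hl0 (j + 1)).ne'
    simp only [birkhoffMean]
    field_simp
  have hfloor : ∀ L : ℝ, 0 ≤ L → |(⌊L / l 0⌋₊ : ℝ) * z₀ - z₀ / l 0 * L| ≤ |z₀| := by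
    intro L hL
    have h0 : 0 ≤ L / l 0 := div_nonneg hL (hl0 0).le
    rw [show (⌊L / l 0⌋₊ : ℝ) * z₀ - z₀ / l 0 * L = ((⌊L / l 0⌋₊ : ℝ) - L / l 0) * z₀ by ring,
      abs_mul]
    refine mul_le_of_le_one_left (abs_nonneg _) (abs_le.2 ⟨?_, ?_⟩)
    · linarith [Nat.lt_floor_add_one (L / l 0)]
    · linarith [Nat.floor_le h0]
  have hsmall : ∀ ε > 0, ∀ᶠ L : ℝ in atTop, |z₀| ≤ ε * L := by
    intro ε hε
    filter_upwards [eventually_ge_atTop (|z₀| / ε)] with L hL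
    rwa [div_le_iff₀' hε] at hL
  refine ⟨p, hp, z₀ / l 0, fun ω ε hε => ?_, ?_⟩
  · have hfreq : ∃ᶠ L in atTop, -(ε / 2) < H ω L := by
      have h1 := frequently_neg_lt_sum_sub_translate e
        (fun j t => (l (j + 1))⁻¹ * birkhoffMean (z (j + 1)) ω (Real.exp t))
        (fun j => ((measurable_birkhoffMean _ _).comp Real.measurable_exp).const_mul _)
        (fun j => (l (j + 1))⁻¹ * ∑ a, |z (j + 1) a|)
        (fun j t => by
          rw [abs_mul, abs_of_pos (inv_pos.2 (hl0 _))]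
          exact mul_le_mul_of_nonneg_left (abs_birkhoffMean_le _ _ (Real.exp_pos _))
            (inv_pos.2 (hl0 _)).le)
        (fun j => -Real.log (l j)) (fun j => -Real.log (l (j + 1))) (half_pos hε)
      refine Real.tendsto_exp_atTop.frequently (h1.mono fun t ht => ?_)
      simpa only [hH, ← sub_eq_add_neg, Real.exp_sub, Real.exp_log (hl0 _)] using ht
    refine (hfreq.and_eventually ((eventually_gt_atTop 0).and (hsmall (ε / 2) (half_pos hε)))).mono
      fun L hL => ?_
    obtain ⟨h1, h2, h3⟩ := hL
    rw [hmass L h2.le, hlog L h2, Real.exp_le_exp]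
    have h4 := abs_le.1 (hfloor L h2.le)
    nlinarith [h4.2]
  · have hae : ∀ j, ∃ m : ℝ, ∀ᵐ ω ∂(Measure.infinitePi fun _ : ℕ => densityMeasure p),
        Tendsto (birkhoffMean (z j) ω) atTop (𝓝 m) := fun j => ae_tendsto_birkhoffMean hp (z j)
    choose m hm using hae
    filter_upwards [ae_all_iff.2 hm] with ω hω ε hε
    have hlim : Tendsto (H ω) atTop (𝓝 0) := by
      have : Tendsto (H ω) atTop (𝓝 (∑ j ∈ Finset.range e,
          ((l (j + 1))⁻¹ * m (j + 1) - (l (j + 1))⁻¹ * m (j + 1)))) := by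
        refine tendsto_finsetSum _ fun j _ => ?_
        exact (((hω (j + 1)).comp (tendsto_id.atTop_div_const (hl0 j))).const_mul _).sub
          (((hω (j + 1)).comp (tendsto_id.atTop_div_const (hl0 (j + 1)))).const_mul _)
      simpa using this
    filter_upwards [hlim.eventually_lt_const (half_pos hε), eventually_gt_atTop 0,
      hsmall (ε / 2) (half_pos hε)] with L h1 h2 h3
    rw [hmass L h2.le, hlog L h2, Real.exp_le_exp]
    have h4 := abs_le.1 (hfloor L h2.le)
    nlinarith [h4.1]

end SymbolicMeasure

section Digits

/-- the integer whose base `b` digits are the first `n` entries of `a` -/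
def leadingNum {b : ℕ} (a : ℕ → Fin b) : ℕ → ℕ
  | 0 => 0
  | n + 1 => b * leadingNum a n + a n

theorem eq_of_leadingNum_eq {b : ℕ} {a a' : ℕ → Fin b} {n : ℕ}
    (h : leadingNum a n = leadingNum a' n) : ∀ k < n, a k = a' k := by
  induction n with
  | zero => simp
  | succ n ih =>
    have hb : 0 < b := (Nat.zero_le _).trans_lt (a n).2
    simp only [leadingNum] at h
    have hmod := congrArg (· % b) h
    have hdiv := congrArg (· / b) h
    simp only [Nat.mul_add_mod, Nat.mod_eq_of_lt (a n).2, Nat.mod_eq_of_lt (a' n).2] at hmod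
    simp only [Nat.mul_add_div hb, Nat.div_eq_of_lt (a n).2, Nat.div_eq_of_lt (a' n).2,
      add_zero] at hdiv
    intro k hk
    rcases (Nat.le_of_lt_succ hk).lt_or_eq with hk | rfl
    · exact ih hdiv k hk
    · exact Fin.ext hmod

theorem pow_mul_ofDigits {b : ℕ} (a : ℕ → Fin b) (n : ℕ) :
    (b : ℝ) ^ n * Real.ofDigits a = leadingNum a n + Real.ofDigits fun k => a (k + n) := by
  have hb : (b : ℝ) ≠ 0 := by
    have := (Nat.zero_le _).trans_lt (a 0).2
    positivity
  have hsum : (b : ℝ) ^ n * ∑ k ∈ Finset.range n, Real.ofDigitsTerm a k = leadingNum a n := by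
    induction n with
    | zero => simp [leadingNum]
    | succ n ih =>
      rw [Finset.sum_range_succ, mul_add, pow_succ', mul_assoc, ih, Real.ofDigitsTerm, leadingNum]
      push_cast
      field_simp
      ring
  rw [Real.ofDigits_eq_sum_add_ofDigits a n, mul_add, hsum]
  field_simp

/-- Digit sequences whose expansions are `b ^ (-n)`-close to `x` have at most four different
initial words of length `n`. -/
theorem exists_leading_label {b : ℕ} (hb : 0 < b) (n : ℕ) (x : ℝ) :
    ∃ g : (ℕ → Fin b) → Fin 4, ∀ a a' : ℕ → Fin b,
      |Real.ofDigits a - x| ≤ ((b : ℝ) ^ n)⁻¹ → |Real.ofDigits a' - x| ≤ ((b : ℝ) ^ n)⁻¹ →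
        g a = g a' → ∀ k < n, a k = a' k := by
  set c : ℤ := ⌊(b : ℝ) ^ n * x⌋ with hc
  have hmem : ∀ a : ℕ → Fin b, |Real.ofDigits a - x| ≤ ((b : ℝ) ^ n)⁻¹ →
      c - 2 ≤ leadingNum a n ∧ (leadingNum a n : ℤ) ≤ c + 1 := by
    intro a ha
    have hpow : (0 : ℝ) < (b : ℝ) ^ n := by positivity
    have h1 : |(b : ℝ) ^ n * Real.ofDigits a - (b : ℝ) ^ n * x| ≤ 1 := by
      rw [← mul_sub, abs_mul, abs_of_pos hpow]
      calc _ ≤ (b : ℝ) ^ n * ((b : ℝ) ^ n)⁻¹ := by gcongr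
        _ = 1 := mul_inv_cancel₀ hpow.ne'
    rw [pow_mul_ofDigits, abs_le] at h1
    have h2 := Real.ofDigits_nonneg fun k => a (k + n)
    have h3 := Real.ofDigits_le_one fun k => a (k + n)
    have h4 := Int.floor_le ((b : ℝ) ^ n * x)
    have h5 := Int.lt_floor_add_one ((b : ℝ) ^ n * x)
    rw [← hc] at h4 h5
    constructor
    · have : (c : ℝ) - 2 ≤ leadingNum a n := by linarith
      exact_mod_cast this
    · have : (leadingNum a n : ℝ) < c + 2 := by linarith
      have : (leadingNum a n : ℤ) < c + 2 := by exact_mod_cast this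
      omega
  refine ⟨fun a => Fin.ofNat 4 (leadingNum a n - (c - 2)).toNat, fun a a' ha ha' h => ?_⟩
  have h1 := hmem a ha
  have h2 := hmem a' ha'
  refine eq_of_leadingNum_eq ?_
  have h3 := congrArg Fin.val h
  simp only [Fin.ofNat] at h3
  omega

theorem exp_neg_le_inv_pow_floor {b : ℕ} (hb : 2 ≤ b) {L : ℝ} (hL : 0 ≤ L) :
    Real.exp (-L) ≤ ((b : ℝ) ^ ⌊L / Real.log b⌋₊)⁻¹ := by
  have hb' : (1 : ℝ) < b := by exact_mod_cast hb
  have hlog := Real.log_pos hb'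
  rw [Real.exp_neg]
  refine inv_anti₀ (by positivity) ?_
  rw [← Real.log_le_iff_le_exp (by positivity), Real.log_pow, ← le_div_iff₀ hlog]
  exact Nat.floor_le (by positivity)

theorem inv_pow_floor_le {b : ℕ} (hb : 2 ≤ b) (L : ℝ) :
    ((b : ℝ) ^ ⌊L / Real.log b⌋₊)⁻¹ ≤ b * Real.exp (-L) := by
  have hb' : (1 : ℝ) < b := by exact_mod_cast hb
  have hlog := Real.log_pos hb'
  rw [Real.exp_neg, ← div_eq_mul_inv, inv_le_comm₀ (by positivity) (by positivity), inv_div,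
    div_le_iff₀ (by positivity), ← pow_succ, ← Real.le_log_iff_exp_le (by positivity),
    Real.log_pow, ← div_le_iff₀ hlog]
  push_cast
  exact (Nat.lt_floor_add_one _).le

end Digits

section Sponge

variable {d : ℕ} {m : Fin d → ℕ} {E : Finset (∀ i, Fin (m i))}

/-- the Sierpiński sponge with base maps `x ↦ (a + x) / m i` -/
noncomputable def sponge (m : Fin d → ℕ) (E : Finset (∀ i, Fin (m i))) :
    DiagIFS d fun i => Fin (m i) :=
  DiagIFS.mk (fun i _ => ((m i : ℝ))⁻¹) (fun i a => ((a : ℕ) : ℝ) / (m i : ℝ)) E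

instance (Φ : DiagIFS d fun i => Fin (m i)) : DiscreteMeasurableSpace Φ.Symb :=
  ⟨fun _ => trivial⟩

instance (Φ : DiagIFS d fun i => Fin (m i)) : DiscreteTopology Φ.Symb := ⟨rfl⟩

theorem coding_sponge_apply (ω : ℕ → (sponge m E).Symb) (i : Fin d) :
    (sponge m E).coding ω i = Real.ofDigits fun k => (ω k).1 i := by
  simp only [DiagIFS.coding, sponge, Real.ofDigits, Real.ofDigitsTerm, Finset.prod_const,
    Finset.card_range]
  refine tsum_congr fun n => ?_
  rw [pow_succ, mul_inv, inv_pow]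
  ring

theorem continuous_coding_sponge : Continuous (sponge m E).coding := by
  refine continuous_pi fun i => ?_
  simp only [coding_sponge_apply]
  refine Real.continuous_ofDigits.comp (continuous_pi fun k => ?_)
  exact (continuous_of_discreteTopology (f := fun a : (sponge m E).Symb => a.1 i)).comp
    (continuous_apply k)

theorem measurable_coding_sponge : Measurable (sponge m E).coding :=
  continuous_coding_sponge.measurable

theorem map_coding_sponge_compl_limitSet (μ : Measure (ℕ → (sponge m E).Symb)) :
    μ.map (sponge m E).coding (sponge m E).limitSetᶜ = 0 := by
  have hclosed : IsClosed (sponge m E).limitSet :=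
    (isCompact_range continuous_coding_sponge).isClosed
  rw [Measure.map_apply measurable_coding_sponge hclosed.measurableSet.compl]
  convert measure_empty (μ := μ)
  ext ω
  simp [DiagIFS.coding_mem]

/-- the symbolic approximate cube of side `exp (-L)` around `ω` -/
def spongeCube (m : Fin d → ℕ) (E : Finset (∀ i, Fin (m i))) (L : ℝ)
    (ω : ℕ → (sponge m E).Symb) : Set (ℕ → (sponge m E).Symb) :=
  {τ | ∀ i, ∀ k < ⌊L / Real.log (m i)⌋₊, (τ k).1 i = (ω k).1 i}

theorem dist_coding_le_of_mem_spongeCube (hm : ∀ i, 2 ≤ m i) {L : ℝ}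
    {ω τ : ℕ → (sponge m E).Symb} (h : τ ∈ spongeCube m E L ω) :
    dist ((sponge m E).coding τ) ((sponge m E).coding ω) ≤ (∑ i, (m i : ℝ)) * Real.exp (-L) := by
  refine (dist_pi_le_iff (by positivity)).2 fun i => ?_
  rw [Real.dist_eq, coding_sponge_apply, coding_sponge_apply]
  refine (Real.abs_ofDigits_sub_ofDigits_le (h i)).trans ((inv_pow_floor_le (hm i) L).trans ?_)
  gcongr
  exact Finset.single_le_sum (f := fun i => (m i : ℝ)) (fun _ _ => Nat.cast_nonneg _)
    (Finset.mem_univ i)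

theorem exists_spongeCube_label (hm : ∀ i, 2 ≤ m i) {L : ℝ} (hL : 0 ≤ L) (x : Fin d → ℝ) :
    ∃ g : (ℕ → (sponge m E).Symb) → Fin d → Fin 4, ∀ ω τ,
      (sponge m E).coding ω ∈ closedBall x (Real.exp (-L)) →
      (sponge m E).coding τ ∈ closedBall x (Real.exp (-L)) → g τ = g ω →
        τ ∈ spongeCube m E L ω := by
  choose g hg using fun i => exists_leading_label (b := m i) (by linarith [hm i])
    ⌊L / Real.log (m i)⌋₊ (x i)
  have hnear : ∀ ω, (sponge m E).coding ω ∈ closedBall x (Real.exp (-L)) → ∀ i,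
      |(Real.ofDigits fun k => (ω k).1 i) - x i| ≤
        ((m i : ℝ) ^ ⌊L / Real.log (m i)⌋₊)⁻¹ := by
    intro ω hω i
    have := (dist_pi_le_iff (Real.exp_pos _).le).1 hω i
    rw [Real.dist_eq, coding_sponge_apply] at this
    exact this.trans (exp_neg_le_inv_pow_floor (hm i) hL)
  refine ⟨fun ω i => g i fun k => (ω k).1 i, fun ω τ hω hτ h i => ?_⟩
  exact hg i _ _ (hnear τ hτ i) (hnear ω hω i) (congrFun h i)

/-- If all approximate cubes of side `exp (-L)` around points of `B` have mass at most `c`, then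
the part of an `exp (-L)`-ball coded by `B` has mass at most `4 ^ d * c`. -/
theorem measure_inter_preimage_closedBall_le (hm : ∀ i, 2 ≤ m i)
    (μ : Measure (ℕ → (sponge m E).Symb)) {L : ℝ} (hL : 0 ≤ L)
    {B : Set (ℕ → (sponge m E).Symb)} {c : ℝ≥0∞} (hB : ∀ ω ∈ B, μ (spongeCube m E L ω) ≤ c)
    (x : Fin d → ℝ) :
    μ ((sponge m E).coding ⁻¹' closedBall x (Real.exp (-L)) ∩ B) ≤ 4 ^ d * c := by
  obtain ⟨g, hg⟩ := exists_spongeCube_label (E := E) hm hL x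
  set T := (sponge m E).coding ⁻¹' closedBall x (Real.exp (-L)) ∩ B with hT
  have hle : ∀ v, μ (T ∩ g ⁻¹' {v}) ≤ c := by
    intro v
    rcases (T ∩ g ⁻¹' {v}).eq_empty_or_nonempty with he | ⟨ω, hω, hv⟩
    · simp [he]
    refine (measure_mono ?_).trans (hB ω hω.2)
    rintro τ ⟨hτ, hτv⟩
    exact hg ω τ hω.1 hτ.1 (hτv.trans hv.symm)
  calc μ T ≤ μ (⋃ v, T ∩ g ⁻¹' {v}) := measure_mono fun ω hω => by simpa using hω
    _ ≤ ∑ v : Fin d → Fin 4, μ (T ∩ g ⁻¹' {v}) := measure_iUnion_fintype_le _ _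
    _ ≤ ∑ _v : Fin d → Fin 4, c := Finset.sum_le_sum fun v _ => hle v
    _ = 4 ^ d * c := by simp

theorem isProductMeasure_infinitePi {p : (sponge m E).Symb → ℝ} (hp : IsProbVec p) :
    IsProductMeasure (sponge m E) (fun _ => p)
      (Measure.infinitePi fun _ : ℕ => densityMeasure p) := by
  have := isProbabilityMeasure_densityMeasure hp
  refine ⟨inferInstance, fun n w => ?_⟩
  have hset : {ω : ℕ → (sponge m E).Symb | ∀ k < n, ω k = w k} =
      Set.pi (Finset.range n : Set ℕ) fun k => (({w k} : Finset (sponge m E).Symb) : Set _) := by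
    ext ω
    simp [Set.mem_pi]
  rw [hset, Measure.infinitePi_pi _ fun k _ => (Set.toFinite _).measurableSet]
  simp only [densityMeasure_finset hp.1, Finset.sum_singleton]
  rw [ENNReal.toReal_prod]
  exact Finset.prod_congr rfl fun k _ => ENNReal.toReal_ofReal (hp.1 _)

theorem exists_bernoulli_spongeCube (hd : 1 ≤ d) (hm : ∀ i, 2 ≤ m i) (hE : E.Nonempty) :
    ∃ p : (sponge m E).Symb → ℝ, IsProbVec p ∧ ∃ δ : ℝ,
      (∀ ω, ∀ ε > 0, ∃ᶠ L in atTop, Real.exp (-(δ + ε) * L) ≤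
        (Measure.infinitePi fun _ : ℕ => densityMeasure p).real (spongeCube m E L ω)) ∧
      ∀ᵐ ω ∂(Measure.infinitePi fun _ : ℕ => densityMeasure p), ∀ ε > 0, ∀ᶠ L in atTop,
        (Measure.infinitePi fun _ : ℕ => densityMeasure p).real (spongeCube m E L ω) ≤
          Real.exp (-(δ - ε) * L) := by
  have : Nonempty (sponge m E).Symb := hE.to_subtype
  set σ : ℕ → Fin d := fun j => Tuple.sort m ⟨min j (d - 1), by omega⟩ with hσ
  have hsurj : ∀ i, ∃ j < d, σ j = i := by
    intro i
    refine ⟨(Tuple.sort m).symm i, Fin.is_lt _, ?_⟩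
    have : min (((Tuple.sort m).symm i : Fin d) : ℕ) (d - 1) = (Tuple.sort m).symm i := by
      have := ((Tuple.sort m).symm i).is_lt
      omega
    simp [hσ, this]
  have hpos : ∀ j, (0 : ℝ) < m (σ j) := fun j => by
    have := hm (σ j)
    positivity
  obtain ⟨p, hp, δ, h1, h2⟩ := exists_bernoulli_symbCube
    (fun j (a : (sponge m E).Symb) => (a.1 (σ j) : ℕ)) hd
    (fun a b hab => Subtype.ext (funext fun i => by
      obtain ⟨j, hj, rfl⟩ := hsurj i
      exact Fin.ext (hab j hj)))
    (fun j => Real.log (m (σ j)))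
    (fun j => Real.log_pos (by exact_mod_cast hm (σ j)))
    (fun j k hjk => Real.log_le_log (hpos j) (by
      have : m (σ j) ≤ m (σ k) := Tuple.monotone_sort m (by
        rw [Fin.mk_le_mk]
        omega)
      exact_mod_cast this))
  have hcube : ∀ L ω, symbCube (fun j (a : (sponge m E).Symb) => (a.1 (σ j) : ℕ)) d
      (fun j => ⌊L / Real.log (m (σ j))⌋₊) ω = spongeCube m E L ω := by
    intro L ω
    ext τ
    constructor
    · intro h i k hk
      obtain ⟨j, hj, rfl⟩ := hsurj i
      exact Fin.ext (h j hj k hk)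
    · intro h j _ k hk
      exact congrArg Fin.val (h (σ j) k hk)
  simp only [hcube] at h1 h2
  exact ⟨p, hp, δ, h1, h2⟩

section Dimension

variable {μ : Measure (ℕ → (sponge m E).Symb)} [IsFiniteMeasure μ] {δ : ℝ}

theorem ofReal_le_map_coding_closedBall (hm : ∀ i, 2 ≤ m i) {L c : ℝ}
    {ω : ℕ → (sponge m E).Symb} (h : c ≤ μ.real (spongeCube m E L ω)) :
    ENNReal.ofReal c ≤ μ.map (sponge m E).coding
      (closedBall ((sponge m E).coding ω) ((∑ i, (m i : ℝ)) * Real.exp (-L))) := by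
  rw [Measure.map_apply measurable_coding_sponge isClosed_closedBall.measurableSet]
  refine ((ENNReal.ofReal_le_ofReal h).trans ?_).trans
    (measure_mono fun τ hτ => dist_coding_le_of_mem_spongeCube hm hτ)
  rw [measureReal_def, ENNReal.ofReal_toReal (measure_ne_top _ _)]

theorem tendsto_const_mul_exp_neg {M : ℝ} (hM : 0 < M) :
    Tendsto (fun L : ℝ => M * Real.exp (-L)) atTop (𝓝[>] 0) := by
  refine tendsto_nhdsWithin_iff.2 ⟨?_, Eventually.of_forall fun L => ?_⟩
  · simpa using (Real.tendsto_exp_neg_atTop_nhds_zero).const_mul M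
  · exact mul_pos hM (Real.exp_pos _)

theorem dimH_limitSet_le_of_spongeCube (hd : 1 ≤ d) (hm : ∀ i, 2 ≤ m i)
    (h : ∀ ω, ∀ ε > 0, ∃ᶠ L in atTop, Real.exp (-(δ + ε) * L) ≤ μ.real (spongeCube m E L ω))
    {t : ℝ≥0} (ht : δ < t) : dimH (sponge m E).limitSet ≤ t := by
  have hM : 0 < ∑ i, (m i : ℝ) := by
    have : Nonempty (Fin d) := ⟨⟨0, hd⟩⟩
    exact Finset.sum_pos (fun i _ => by have := hm i; positivity) Finset.univ_nonempty
  refine dimH_le_of_frequently_le_measure_closedBall (ν := μ.map (sponge m E).coding) ?_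
  rintro _ ⟨ω, rfl⟩
  refine (tendsto_const_mul_exp_neg hM).frequently ?_
  have hε : 0 < (t - δ) / 2 := by linarith
  have hlarge : ∀ᶠ L : ℝ in atTop, (∑ i, (m i : ℝ)) ^ (t : ℝ) ≤ Real.exp ((t - δ) / 2 * L) :=
    (Real.tendsto_exp_atTop.comp (tendsto_id.const_mul_atTop hε)).eventually_ge_atTop _
  refine ((h ω _ hε).and_eventually hlarge).mono fun L hL => ?_
  refine (ENNReal.ofReal_le_ofReal ?_).trans (ofReal_le_map_coding_closedBall hm hL.1)
  rw [Real.mul_rpow hM.le (Real.exp_pos _).le, ← Real.exp_mul]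
  calc _ ≤ Real.exp ((t - δ) / 2 * L) * Real.exp (-L * t) := by
        gcongr
        exact hL.2
    _ = _ := by
        rw [← Real.exp_add]
        congr 1
        ring

theorem le_measDim_of_spongeCube [NeZero μ] (hd : 1 ≤ d) (hm : ∀ i, 2 ≤ m i)
    (h : ∀ ω, ∀ ε > 0, ∃ᶠ L in atTop, Real.exp (-(δ + ε) * L) ≤ μ.real (spongeCube m E L ω))
    (h' : ∀ᵐ ω ∂μ, ∀ ε > 0, ∀ᶠ L in atTop,
      μ.real (spongeCube m E L ω) ≤ Real.exp (-(δ - ε) * L))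
    {s : ℝ≥0} (hs : s < δ) : (s : ℝ≥0∞) ≤ measDim (μ.map (sponge m E).coding) := by
  have hM : 0 < ∑ i, (m i : ℝ) := by
    have : Nonempty (Fin d) := ⟨⟨0, hd⟩⟩
    exact Finset.sum_pos (fun i _ => by have := hm i; positivity) Finset.univ_nonempty
  set B : ℕ → Set (ℕ → (sponge m E).Symb) := fun n =>
    {ω | ∀ L : ℝ, n ≤ L → μ.real (spongeCube m E L ω) ≤ Real.exp (-s * L)} with hBdef
  obtain ⟨n, hn⟩ : ∃ n, μ (B n) ≠ 0 := by
    by_contra! h0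
    have hnull := measure_iUnion_null h0
    have hae : ∀ᵐ ω ∂μ, ω ∈ ⋃ n, B n := by
      filter_upwards [h'] with ω hω
      obtain ⟨L₀, hL₀⟩ := eventually_atTop.1 (hω (δ - s) (by linarith))
      refine mem_iUnion.2 ⟨⌈L₀⌉₊, fun L hL => ?_⟩
      have := hL₀ L ((Nat.le_ceil L₀).trans hL)
      rwa [sub_sub_cancel] at this
    have := (measure_eq_zero_iff_ae_notMem.1 hnull).and hae
    simp only [not_and_self_iff, eventually_false_iff_eq_bot, ae_eq_bot] at this
    exact NeZero.ne μ this
  refine le_measDim_of_absolutelyContinuous (ν' := (μ.restrict (B n)).map (sponge m E).coding)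
    (map_coding_sponge_compl_limitSet μ) ?_
    (Measure.restrict_le_self.absolutelyContinuous.map measurable_coding_sponge) ?_
    (C := 4 ^ d) (by positivity) (Real.exp_pos (-n)) ?_
  · rintro _ ⟨ω, rfl⟩ ρ hρ
    have hev := (tendsto_const_mul_exp_neg hM).eventually (Ioo_mem_nhdsGT hρ)
    obtain ⟨L, hL, hLρ⟩ := ((h ω 1 one_pos).and_eventually hev).exists
    refine ((ENNReal.ofReal_pos.2 (Real.exp_pos _)).trans_le
      ((ofReal_le_map_coding_closedBall hm hL).trans (measure_mono ?_))).ne'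
    exact closedBall_subset_ball hLρ.2
  · intro h0
    have := congrArg (fun ν => ν univ) h0
    simp only [Measure.map_apply measurable_coding_sponge MeasurableSet.univ, preimage_univ,
      Measure.restrict_apply_univ, Measure.coe_zero, Pi.zero_apply] at this
    exact hn this
  · intro x ρ hρ hρn
    obtain ⟨L, rfl⟩ : ∃ L, ρ = Real.exp (-L) := ⟨-Real.log ρ, by rw [neg_neg, Real.exp_log hρ]⟩
    rw [Real.exp_lt_exp, neg_lt_neg_iff] at hρn
    rw [Measure.map_apply measurable_coding_sponge isClosed_closedBall.measurableSet,
      Measure.restrict_apply (measurable_coding_sponge isClosed_closedBall.measurableSet)]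
    refine (measure_inter_preimage_closedBall_le hm μ ((Nat.cast_nonneg n).trans hρn.le)
      (c := ENNReal.ofReal (Real.exp (-s * L))) (fun ω hω => ?_) x).trans_eq ?_
    · exact (ENNReal.le_ofReal_iff_toReal_le (measure_ne_top _ _) (Real.exp_pos _).le).2
        (hω L hρn.le)
    · rw [ENNReal.ofReal_mul (by positivity), ENNReal.ofReal_pow (by norm_num), ← Real.exp_mul]
      congr 2
      · norm_num
      · ring_nf

end Dimension

end Sponge

/-- **Kenyon–Peres theorem.** The Hausdorff dimension of a Sierpiński sponge (base
maps `φ_{i,a}(x) = (a+x)/m_i` with distinct integers `m_i ≥ 2`) equals the supremum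
of the Hausdorff dimensions of its Bernoulli measures. -/
theorem sierpinski_sponge_dimH {d : ℕ} (hd : 1 ≤ d) (m : Fin d → ℕ)
    (hm : ∀ i, 2 ≤ m i) (hminj : Function.Injective m)
    (E : Finset (∀ i, Fin (m i))) (hE : E.Nonempty) :
    dimH (DiagIFS.limitSet
        (DiagIFS.mk (A := fun i => Fin (m i)) (fun i _ => ((m i : ℝ))⁻¹)
          (fun i a => ((a : ℕ) : ℝ) / (m i : ℝ)) E)) =
      sSup (bernoulliDims
        (DiagIFS.mk (A := fun i => Fin (m i)) (fun i _ => ((m i : ℝ))⁻¹)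
          (fun i a => ((a : ℕ) : ℝ) / (m i : ℝ)) E)) := by
  change dimH (sponge m E).limitSet = sSup (bernoulliDims (sponge m E))
  refine le_antisymm ?_ (sSup_le ?_)
  · obtain ⟨p, hp, δ, h1, h2⟩ := exists_bernoulli_spongeCube hd hm hE
    have hμ := isProductMeasure_infinitePi hp
    have := hμ.1
    refine le_trans ?_ (le_sSup ⟨p, hp, _, hμ, rfl⟩)
    by_contra! hlt
    obtain ⟨t, ht1, ht2⟩ := ENNReal.lt_iff_exists_nnreal_btwn.1 hlt
    obtain ⟨s, hs1, hs2⟩ := ENNReal.lt_iff_exists_nnreal_btwn.1 ht1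
    have hδ : (t : ℝ) ≤ δ := by
      by_contra! hδ
      exact absurd (dimH_limitSet_le_of_spongeCube hd hm h1 hδ) (not_le.2 ht2)
    have hst : (s : ℝ) < t := by exact_mod_cast hs2
    exact absurd (le_measDim_of_spongeCube hd hm h1 h2 (hst.trans_le hδ)) (not_le.2 hs1)
  · rintro _ ⟨p, -, μ, hμ, rfl⟩
    have := hμ.1
    exact measDim_le_dimH (map_coding_sponge_compl_limitSet μ)

end SelfAffineSponge
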